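/- Complementation of a repair is a maximal independent set (Proposition 3 of the paper): For every instance I and every repair I' of I all of whose facts belong (as positive literals) to Hull(I,C), the set Compl(I') = I' ∪ { ¬q : ¬q ∈ Hull(I,C) and q ∉ I' } is a maximal independent set of the extended conflict hypergraph G(I,C). -/

import Mathlib

/-!
Setting: facts form a type `F` with decidable equality, instances are finite sets of facts.
`C` is a set of conflicts, each a pair `(P,N)` of finite sets of facts with `P` nonempty
and `P ∩ N = ∅`.
-/

variable {F : Type*} [DecidableEq F]

/-- An instance `J` is consistent: no conflict `(P,N) ∈ C` has `P ⊆ J` and `N ∩ J = ∅`. -/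
def CConsistent (C : Set (Finset F × Finset F)) (J : Finset F) : Prop :=
  ¬ ∃ c ∈ C, c.1 ⊆ J ∧ c.2 ∩ J = ∅

/-- Symmetric difference `Δ(I,J) = (I∖J) ∪ (J∖I)` of two instances. -/
def CDelta (I J : Finset F) : Finset F := (I \ J) ∪ (J \ I)

/-- `I'` is a repair of `I`: a consistent instance such that no consistent instance `J`
satisfies `Δ(I,J) ⊊ Δ(I,I')`. -/
def CRepair (C : Set (Finset F × Finset F)) (I I' : Finset F) : Prop :=
  CConsistent C I' ∧ ¬ ∃ J : Finset F, CConsistent C J ∧ CDelta I J ⊂ CDelta I I'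

/-- A literal: either a fact `p` or a negated fact `¬p`. -/
inductive DBLit (F : Type*) where
  | pos : F → DBLit F
  | neg : F → DBLit F

/-- The hull `Hull(I,C)`: the least set of literals containing every fact of `I`
(positively) and such that for every conflict `(P,N) ∈ C` all of whose positive facts
are in the hull, every `q ∈ N` has both `q` and `¬q` in the hull. -/
inductive InHull (C : Set (Finset F × Finset F)) (I : Finset F) : DBLit F → Prop
  | base {p : F} (hp : p ∈ I) : InHull C I (DBLit.pos p)
  | stepPos {c : Finset F × Finset F} {q : F} (hc : c ∈ C)
      (hall : ∀ p ∈ c.1, InHull C I (DBLit.pos p)) (hq : q ∈ c.2) :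
      InHull C I (DBLit.pos q)
  | stepNeg {c : Finset F × Finset F} {q : F} (hc : c ∈ C)
      (hall : ∀ p ∈ c.1, InHull C I (DBLit.pos p)) (hq : q ∈ c.2) :
      InHull C I (DBLit.neg q)

/-- Hyperedges of the extended conflict hypergraph `G(I,C)`: conflict edges
`P ∪ {¬q : q ∈ N}` for conflicts `(P,N) ∈ C` all of whose literals lie in the hull,
and stabilizing edges `{q, ¬q}` for facts `q` with both `q` and `¬q` in the hull. -/
def IsEdge (C : Set (Finset F × Finset F)) (I : Finset F) (e : Set (DBLit F)) : Prop :=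
  (∃ c ∈ C, e = DBLit.pos '' (↑c.1 : Set F) ∪ DBLit.neg '' (↑c.2 : Set F) ∧
      ∀ l ∈ e, InHull C I l) ∨
  (∃ q : F, InHull C I (DBLit.pos q) ∧ InHull C I (DBLit.neg q) ∧
      e = {DBLit.pos q, DBLit.neg q})

/-- An independent set of `G(I,C)`: a subset of the hull containing no hyperedge. -/
def Indep (C : Set (Finset F × Finset F)) (I : Finset F) (M : Set (DBLit F)) : Prop :=
  (∀ l ∈ M, InHull C I l) ∧ ∀ e : Set (DBLit F), IsEdge C I e → ¬ e ⊆ M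

/-- A maximal independent set of `G(I,C)`: an independent set such that no strictly
larger subset of the hull is independent. -/
def MaxIndep (C : Set (Finset F × Finset F)) (I : Finset F) (M : Set (DBLit F)) : Prop :=
  Indep C I M ∧ ∀ M' : Set (DBLit F), M ⊂ M' → ¬ Indep C I M'

/-- Proposition 3: for every repair `I'` of `I` all of whose facts belong (as positive
literals) to the hull, `Compl(I') = I' ∪ { ¬q : ¬q ∈ Hull(I,C), q ∉ I' }` is a maximal
independent set of the extended conflict hypergraph `G(I,C)`. -/
theorem compl_of_repair_is_maximal_independent
    (C : Set (Finset F × Finset F))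
    (hC : ∀ c ∈ C, c.1.Nonempty ∧ c.1 ∩ c.2 = ∅)
    (I I' : Finset F) (hrep : CRepair C I I')
    (hhull : ∀ p ∈ I', InHull C I (DBLit.pos p)) :
    MaxIndep C I
      (DBLit.pos '' (↑I' : Set F) ∪
        DBLit.neg '' {q : F | InHull C I (DBLit.neg q) ∧ q ∉ I'}) := by
  obtain ⟨hcons, hmin⟩ := hrep
  have hneg : ∀ q, InHull C I (DBLit.neg q) → q ∉ I' →
      DBLit.neg q ∈ DBLit.pos '' (↑I' : Set F) ∪
        DBLit.neg '' {q : F | InHull C I (DBLit.neg q) ∧ q ∉ I'} :=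
    fun q h h' => Or.inr ⟨q, ⟨h, h'⟩, rfl⟩
  refine ⟨⟨?_, ?_⟩, ?_⟩
  · rintro l (⟨p, hp, rfl⟩ | ⟨q, ⟨hq, -⟩, rfl⟩)
    exacts [hhull p hp, hq]
  · rintro e (⟨c, hc, rfl, -⟩ | ⟨q, -, -, rfl⟩) hsub
    · refine hcons ⟨c, hc, fun p hp => ?_, ?_⟩
      · simpa using hsub (Or.inl ⟨p, hp, rfl⟩)
      · refine Finset.eq_empty_of_forall_notMem fun q hq => ?_
        obtain ⟨hqN, hqI⟩ := Finset.mem_inter.1 hq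
        have := hsub (Or.inr ⟨q, hqN, rfl⟩)
        simp_all
    · have hpos := hsub (Set.mem_insert _ _)
      have hng := hsub (Set.mem_insert_of_mem _ rfl)
      simp_all
  · rintro M' ⟨hMM', hnot⟩ ⟨hM'hull, hM'edge⟩
    obtain ⟨l, hl, hlM⟩ := Set.not_subset.1 hnot
    have stab : ∀ q, DBLit.pos q ∈ M' → DBLit.neg q ∈ M' → False := fun q hp hn =>
      hM'edge _ (Or.inr ⟨q, hM'hull _ hp, hM'hull _ hn, rfl⟩)
        (Set.insert_subset hp (Set.singleton_subset_iff.2 hn))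
    cases l with
    | neg q =>
      by_cases hq : q ∈ I'
      · exact stab q (hMM' (Or.inl ⟨q, hq, rfl⟩)) hl
      · exact hlM (hneg q (hM'hull _ hl) hq)
    | pos q =>
      have hqI' : q ∉ I' := fun h => hlM (Or.inl ⟨q, h, rfl⟩)
      have hqI : q ∈ I := by
        cases hM'hull _ hl with
        | base h => exact h
        | stepPos hc hall hq =>
          exact (stab q hl (hMM' (hneg q (.stepNeg hc hall hq) hqI'))).elim
      have hJM' : ∀ p ∈ insert q I', DBLit.pos p ∈ M' := by
        intro p hp
        rcases Finset.mem_insert.1 hp with rfl | hp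
        exacts [hl, hMM' (Or.inl ⟨p, hp, rfl⟩)]
      refine hmin ⟨insert q I', ?_, ?_⟩
      · rintro ⟨c, hc, hP, hN⟩
        have hpos : ∀ p ∈ c.1, DBLit.pos p ∈ M' := fun p hp => hJM' p (hP hp)
        have hedge : DBLit.pos '' (↑c.1 : Set F) ∪ DBLit.neg '' (↑c.2 : Set F) ⊆ M' := by
          rintro l (⟨p, hp, rfl⟩ | ⟨r, hr, rfl⟩)
          · exact hpos p hp
          · refine hMM' (hneg r (.stepNeg hc (fun p hp => hM'hull _ (hpos p hp)) hr) fun h => ?_)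
            have : r ∈ c.2 ∩ insert q I' := Finset.mem_inter.2 ⟨hr, Finset.mem_insert_of_mem h⟩
            simp [hN] at this
        exact hM'edge _ (Or.inl ⟨c, hc, rfl, fun l hl => hM'hull l (hedge hl)⟩) hedge
      · refine (Finset.ssubset_iff_of_subset fun x hx => ?_).2 ⟨q, ?_, ?_⟩
        · simp only [CDelta, Finset.mem_union, Finset.mem_sdiff, Finset.mem_insert] at hx ⊢
          grind
        · simp [CDelta, hqI, hqI']
        · simp [CDelta, hqI]
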